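/- Fix β ∈ (0,1) and α > 1/4. For every k ∈ ℕ there exists a constant C = C(β, α, k) such that for all N ≥ 1 and all h with 0 ≤ h ≤ N^{−α}: E_{z ~ N(μ, γ²/N)}[ ( e^z·sinh(2h)/(e^z·cosh(2h) + e^{−z}) − q₁(β,h) )^{2k} ] ≤ C·(h²/N)^k, where γ > 0 is defined by 1/γ² = 1/β² − (1 − tanh⁴(h)) and μ = γ²·tanh²(h). -/

import Mathlib

open MeasureTheory ProbabilityTheory

noncomputable section

/-- Standard Gaussian measure on `ℝ`. -/
def stdGaussian : Measure ℝ := gaussianReal 0 1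

/-- The overlap constant `q_{β,h}`, the unique solution in `(0,1]` of the replica-symmetric
fixed point equation (set to `0` for `h = 0`). -/
def qOverlap (β h : ℝ) : ℝ :=
  if h = 0 then 0 else
    sSup {q : ℝ | q ∈ Set.Ioc (0 : ℝ) 1 ∧
      q = ∫ g, Real.tanh (β * g * Real.sqrt q + h) ^ 2 ∂stdGaussian}

/-- `q₁(β,h) = E tanh(β g √q_{β,h} + h)`. -/
def q1 (β h : ℝ) : ℝ :=
  ∫ g, Real.tanh (β * g * Real.sqrt (qOverlap β h) + h) ∂stdGaussian

/-- Hyperbolic secant. -/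
def sech (x : ℝ) : ℝ := 1 / Real.cosh x

/-- The Almeida–Thouless condition for `(β,h)`. -/
def ATCond (β h : ℝ) : Prop :=
  β ^ 2 * ∫ g, sech (β * g * Real.sqrt (qOverlap β h) + h) ^ 4 ∂stdGaussian < 1

/-- The AT condition with gap at least `g0`. -/
def ATgap (β h g0 : ℝ) : Prop :=
  β ^ 2 * ∫ g, sech (β * g * Real.sqrt (qOverlap β h) + h) ^ 4 ∂stdGaussian ≤ 1 - g0

/-- The one-dimensional RGD/AMP update map `f_{β,λ}`. -/
def fbl (β lam z : ℝ) : ℝ :=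
  ∫ g, Real.tanh (β * g * Real.sqrt (qOverlap β (β * lam * z)) + β * lam * z) ∂stdGaussian

/-- `h_* = inf{h ≥ 0 : (β,h) satisfies AT}`. -/
def hStar (β : ℝ) : ℝ := sInf {h : ℝ | 0 ≤ h ∧ ATCond β h}

theorem aux_hasDerivAt_tanh (x : ℝ) : HasDerivAt Real.tanh (1 - Real.tanh x ^ 2) x := by
  have hc : Real.cosh x ≠ 0 := (Real.cosh_pos x).ne'
  have h := (Real.hasDerivAt_sinh x).div (Real.hasDerivAt_cosh x) hc
  have e : Real.tanh = Real.sinh / Real.cosh := by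
    funext y; simp [Real.tanh_eq_sinh_div_cosh]
  rw [← e] at h
  refine h.congr_deriv ?_
  rw [Real.tanh_eq_sinh_div_cosh]
  field_simp

theorem aux_tanh_sq_le_one (x : ℝ) : Real.tanh x ^ 2 ≤ 1 := by
  have hc := Real.cosh_pos x
  rw [Real.tanh_eq_sinh_div_cosh, div_pow, div_le_one (by positivity)]
  nlinarith [Real.cosh_sq x]

theorem aux_abs_tanh_le (x : ℝ) : |Real.tanh x| ≤ |x| := by
  have := Convex.norm_image_sub_le_of_norm_hasDerivWithin_le (C := 1) (x := (0:ℝ)) (y := x)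
    (s := Set.univ) (fun x _ => (aux_hasDerivAt_tanh x).hasDerivWithinAt)
    (fun x _ => by
      rw [Real.norm_eq_abs, abs_le]
      constructor <;> nlinarith [aux_tanh_sq_le_one x, sq_nonneg (Real.tanh x)])
    convex_univ trivial trivial
  simpa using this

theorem aux_tanh_sub (x : ℝ) : |Real.tanh x - x| ≤ |x| ^ 3 := by
  have := Convex.norm_image_sub_le_of_norm_hasDerivWithin_le (C := |x| ^ 2) (x := (0:ℝ)) (y := x)
    (s := Set.Icc (-|x|) |x|) (f := fun y => Real.tanh y - y)
    (fun x _ => ((aux_hasDerivAt_tanh x).sub (hasDerivAt_id x)).hasDerivWithinAt)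
    (fun y hy => by
      have h1 : |Real.tanh y| ≤ |x| := (aux_abs_tanh_le y).trans (abs_le.2 hy)
      rw [Real.norm_eq_abs, show 1 - Real.tanh y ^ 2 - 1 = - Real.tanh y ^ 2 by ring, abs_neg,
        abs_pow]
      gcongr)
    (convex_Icc _ _) (by simp) (by simp [neg_abs_le, le_abs_self])
  rw [pow_succ]
  simpa using this

theorem aux_F_lip (h : ℝ) (hh : 0 ≤ h) (z : ℝ) :
    |Real.exp z * Real.sinh (2 * h) / (Real.exp z * Real.cosh (2 * h) + Real.exp (-z))
      - Real.tanh h| ≤ h * |z| := by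
  set s := Real.sinh (2 * h) with hs
  set c := Real.cosh (2 * h) with hc
  have hc0 : 0 < c := Real.cosh_pos _
  have hs0 : 0 ≤ s := Real.sinh_nonneg_iff.2 (by linarith)
  have hsc : s ≤ 2 * h * c := by
    have := (le_abs_self _).trans (aux_abs_tanh_le (2 * h))
    rw [Real.tanh_eq_sinh_div_cosh, div_le_iff₀ hc0, abs_of_nonneg (by linarith)] at this
    exact this
  have hF0 : Real.exp 0 * s / (Real.exp 0 * c + Real.exp (-0)) = Real.tanh h := by
    have h1 := Real.cosh_pos h
    have h2 := Real.cosh_sq h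
    simp only [Real.exp_zero, neg_zero, one_mul]
    rw [Real.tanh_eq_sinh_div_cosh, hs, hc, Real.sinh_two_mul, Real.cosh_two_mul,
      div_eq_div_iff (by positivity) (by positivity)]
    linear_combination (Real.sinh h) * h2
  rw [← hF0]
  have := Convex.norm_image_sub_le_of_norm_hasDerivWithin_le (C := h) (x := (0:ℝ)) (y := z)
    (s := Set.univ) (f := fun y => Real.exp y * s / (Real.exp y * c + Real.exp (-y)))
    (f' := fun y => 2 * s / (Real.exp y * c + Real.exp (-y)) ^ 2)
    (fun y _ => by
      have e1 := Real.hasDerivAt_exp y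
      have e2 : HasDerivAt (fun y : ℝ => Real.exp (-y)) (-Real.exp (-y)) y := by
        simpa using (hasDerivAt_neg y).exp
      have hD : Real.exp y * c + Real.exp (-y) ≠ 0 := by positivity
      have := (e1.mul_const s).div ((e1.mul_const c).add e2) hD
      refine (HasDerivAt.congr_deriv this ?_).hasDerivWithinAt
      have e3 : Real.exp y * Real.exp (-y) = 1 := by rw [← Real.exp_add]; simp
      congr 1
      simp only [Pi.add_apply]
      linear_combination (2 * s) * e3)
    (fun y _ => by
      have e3 : Real.exp y * Real.exp (-y) = 1 := by rw [← Real.exp_add]; simp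
      rw [Real.norm_eq_abs, abs_of_nonneg (by positivity), div_le_iff₀ (by positivity)]
      have : 4 * c ≤ (Real.exp y * c + Real.exp (-y)) ^ 2 := by
        have e4 : (Real.exp y * c + Real.exp (-y)) ^ 2
          = (Real.exp y * c - Real.exp (-y)) ^ 2 + 4 * c := by linear_combination (4 * c) * e3
        rw [e4]; nlinarith [sq_nonneg (Real.exp y * c - Real.exp (-y))]
      nlinarith)
    convex_univ trivial trivial
  simpa using this

instance aux_prob : IsProbabilityMeasure stdGaussian := by
  unfold _root_.stdGaussian; infer_instance

theorem aux_memLp (a b : ℝ) (n : ℕ) : MemLp (fun g : ℝ => a * |g| + b) n stdGaussian := by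
  have h : MemLp (id : ℝ → ℝ) n stdGaussian := memLp_id_gaussianReal' _ (by simp)
  exact (h.norm.const_mul a).add (memLp_const b)

theorem aux_int (a b : ℝ) (ha : 0 ≤ a) (hb : 0 ≤ b) (n : ℕ) :
    Integrable (fun g : ℝ => (a * |g| + b) ^ n) stdGaussian := by
  have := (aux_memLp a b n).integrable_norm_pow'
  refine this.congr (Filter.Eventually.of_forall fun g => ?_)
  simp only [Real.norm_eq_abs]
  rw [abs_of_nonneg (by positivity)]

theorem aux_int_id : Integrable (fun g : ℝ => g) stdGaussian := by
  have h : MemLp (id : ℝ → ℝ) (1:ℕ) stdGaussian := memLp_id_gaussianReal' _ (by simp)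
  exact h.integrable (by simp)

theorem aux_int_sq : Integrable (fun g : ℝ => g ^ 2) stdGaussian := by
  have := aux_int 1 0 (by simp) (by simp) 2
  simpa using this

theorem aux_mean : ∫ g, g ∂stdGaussian = 0 := integral_id_gaussianReal

theorem aux_second : ∫ g, g ^ 2 ∂stdGaussian = 1 := by
  have h : Var[fun x ↦ x; gaussianReal 0 1] = ((1 : NNReal) : ℝ) := variance_fun_id_gaussianReal
  rw [variance_of_integral_eq_zero (by fun_prop) integral_id_gaussianReal] at h
  simpa [_root_.stdGaussian] using h

theorem aux_q_nonneg (β h : ℝ) : 0 ≤ qOverlap β h := by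
  unfold qOverlap
  split_ifs
  · rfl
  · exact Real.sSup_nonneg fun q hq => hq.1.1.le

theorem aux_q_le (β h : ℝ) (hβ0 : 0 < β) (hβ1 : β < 1) :
    qOverlap β h ≤ h ^ 2 / (1 - β ^ 2) := by
  have hb : 0 < 1 - β ^ 2 := by nlinarith
  unfold qOverlap
  split_ifs
  · positivity
  refine Real.sSup_le ?_ (by positivity)
  rintro q ⟨⟨hq0, hq1⟩, hq⟩
  have hX : ∫ g, (β * g * Real.sqrt q + h) ^ 2 ∂stdGaussian = β ^ 2 * q + h ^ 2 := by
    have e : (fun g : ℝ => (β * g * Real.sqrt q + h) ^ 2) =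
        fun g => β ^ 2 * q * g ^ 2 + (2 * β * Real.sqrt q * h) * g + h ^ 2 := by
      funext g
      linear_combination (β ^ 2 * g ^ 2) * Real.sq_sqrt hq0.le
    have i1 := aux_int_sq.const_mul (β ^ 2 * q)
    have i2 := aux_int_id.const_mul (2 * β * Real.sqrt q * h)
    have i3 : Integrable (fun g : ℝ => β ^ 2 * q * g ^ 2 + (2 * β * Real.sqrt q * h) * g)
      stdGaussian := i1.add i2
    rw [e, integral_add i3 (integrable_const _), integral_add i1 i2,
      integral_const_mul, integral_const_mul, aux_mean, aux_second]
    simp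
  have hle : ∫ g, Real.tanh (β * g * Real.sqrt q + h) ^ 2 ∂stdGaussian
      ≤ ∫ g, (β * g * Real.sqrt q + h) ^ 2 ∂stdGaussian := by
    refine integral_mono_of_nonneg (Filter.Eventually.of_forall fun g => by positivity) ?_
      (Filter.Eventually.of_forall fun g => sq_le_sq.2 (aux_abs_tanh_le _))
    have e : (fun g : ℝ => (β * g * Real.sqrt q + h) ^ 2) =
        fun g => β ^ 2 * q * g ^ 2 + (2 * β * Real.sqrt q * h) * g + h ^ 2 := by
      funext g
      linear_combination (β ^ 2 * g ^ 2) * Real.sq_sqrt hq0.le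
    rw [e]
    exact ((aux_int_sq.const_mul _).add (aux_int_id.const_mul _)).add (integrable_const _)
  rw [le_div_iff₀ hb]
  rw [hX, ← hq] at hle
  linarith

theorem aux_cont_tanh : Continuous Real.tanh :=
  continuous_iff_continuousAt.2 fun x => (aux_hasDerivAt_tanh x).continuousAt

theorem aux_q1 (β : ℝ) (hβ0 : 0 < β) (hβ1 : β < 1) :
    ∃ M : ℝ, 0 ≤ M ∧ ∀ h : ℝ, 0 ≤ h → |q1 β h - h| ≤ M * h ^ 3 := by
  have hb : 0 < 1 - β ^ 2 := by nlinarith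
  set B := Real.sqrt (1 / (1 - β ^ 2)) with hB
  have hB0 : 0 ≤ B := Real.sqrt_nonneg _
  refine ⟨∫ g, (B * |g| + 1) ^ 3 ∂stdGaussian, integral_nonneg fun g => by positivity, ?_⟩
  intro h hh
  set r := Real.sqrt (qOverlap β h) with hr
  have hr0 : 0 ≤ r := Real.sqrt_nonneg _
  have hrB : r ≤ h * B := by
    rw [hr, hB]
    apply Real.sqrt_le_iff.2 ⟨by positivity, ?_⟩
    rw [mul_pow, Real.sq_sqrt (by positivity), mul_one_div]
    exact aux_q_le β h hβ0 hβ1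
  have hint : Integrable (fun g => β * g * r + h) stdGaussian := by
    have := (aux_int_id.const_mul (β * r)).add (integrable_const h)
    refine this.congr (Filter.Eventually.of_forall fun g => ?_)
    simp only [Pi.add_apply]; ring
  have hEX : ∫ g, (β * g * r + h) ∂stdGaussian = h := by
    have e : (fun g : ℝ => β * g * r + h) = fun g => (β * r) * g + h := by
      funext g; ring
    rw [e, integral_add (aux_int_id.const_mul _) (integrable_const _), integral_const_mul, aux_mean]
    simp
  have hXg : ∀ g : ℝ, |β * g * r + h| ≤ h * (B * |g| + 1) := by
    intro g
    calc |β * g * r + h| ≤ |β * g * r| + |h| := abs_add_le _ _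
      _ = β * (|g| * r) + h := by
        rw [abs_mul, abs_mul, abs_of_pos hβ0, abs_of_nonneg hr0, abs_of_nonneg hh]; ring
      _ ≤ 1 * (|g| * (h * B)) + h := by gcongr
      _ = _ := by ring
  have htint : Integrable (fun g => Real.tanh (β * g * r + h)) stdGaussian := by
    refine hint.norm.mono' (aux_cont_tanh.comp (by fun_prop)).aestronglyMeasurable
      (Filter.Eventually.of_forall fun g => aux_abs_tanh_le _)
  have : q1 β h - h = ∫ g, (Real.tanh (β * g * r + h) - (β * g * r + h)) ∂stdGaussian := by
    rw [integral_sub htint hint, hEX]; rfl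
  rw [this, mul_comm, ← integral_const_mul, ← Real.norm_eq_abs]
  refine norm_integral_le_of_norm_le ((aux_int B 1 hB0 zero_le_one 3).const_mul _)
    (Filter.Eventually.of_forall fun g => ?_)
  rw [← mul_pow]
  exact (aux_tanh_sub _).trans (pow_le_pow_left₀ (abs_nonneg _) (hXg g) 3)

/-- Control of the effective magnetization: for `β ∈ (0,1)`, `α > 1/4`,
and any `k`, there is `C = C(β,α,k)` such that for all `N ≥ 1` and `0 ≤ h ≤ N^{−α}`,
`E_{z ~ N(μ, γ²/N)}[(e^z sinh(2h)/(e^z cosh(2h)+e^{−z}) − q₁(β,h))^{2k}] ≤ C (h²/N)^k`,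
where `1/γ² = 1/β² − (1 − tanh⁴ h)`, `γ > 0`, and `μ = γ² tanh² h`. -/
theorem stmt9 (β α : ℝ) (hβ0 : 0 < β) (hβ1 : β < 1) (hα : 1 / 4 < α) (k : ℕ) :
    ∃ C : ℝ, 0 < C ∧ ∀ N : ℕ, 1 ≤ N → ∀ h : ℝ, 0 ≤ h → h ≤ (N : ℝ) ^ (-α) →
      ∀ γ μ0 : ℝ, 0 < γ →
        1 / γ ^ 2 = 1 / β ^ 2 - (1 - Real.tanh h ^ 4) →
        μ0 = γ ^ 2 * Real.tanh h ^ 2 →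
        (∫ z, (Real.exp z * Real.sinh (2 * h) /
              (Real.exp z * Real.cosh (2 * h) + Real.exp (-z)) - q1 β h) ^ (2 * k)
            ∂gaussianReal μ0 (Real.toNNReal (γ ^ 2 / N)))
          ≤ C * (h ^ 2 / N) ^ k := by
  obtain ⟨M, hM0, hM⟩ := aux_q1 β hβ0 hβ1
  have hb : 0 < 1 / β ^ 2 - 1 := by
    have : 1 < 1 / β ^ 2 := by
      rw [lt_div_iff₀ (by positivity)]; nlinarith
    linarith
  set G := 1 / (1 / β ^ 2 - 1) with hG
  have hG0 : 0 < G := by positivity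
  set A := G + 1 + M with hA
  have hA0 : 0 ≤ A := by positivity
  set Γ := Real.sqrt G with hΓ
  have hΓ0 : 0 ≤ Γ := Real.sqrt_nonneg _
  have hI0 : 0 ≤ ∫ g, (Γ * |g| + A) ^ (2 * k) ∂stdGaussian :=
    integral_nonneg fun g => by positivity
  refine ⟨1 + ∫ g, (Γ * |g| + A) ^ (2 * k) ∂stdGaussian, by positivity, ?_⟩
  intro N hN h hh hhN γ μ0 hγ hγeq hμ
  have hN0 : (0 : ℝ) < N := by exact_mod_cast hN
  have hN1 : (1 : ℝ) ≤ N := by exact_mod_cast hN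
  have hγG : γ ^ 2 ≤ G := by
    have h1 : 1 / β ^ 2 - 1 ≤ 1 / γ ^ 2 := by
      have : 0 ≤ Real.tanh h ^ 4 := by positivity
      linarith
    rw [hG, le_div_iff₀ hb]
    rw [le_div_iff₀ (by positivity)] at h1
    linarith
  have hγΓ : γ ≤ Γ := Real.le_sqrt_of_sq_le hγG
  set R := Real.sqrt N with hR
  have hR0 : 0 < R := Real.sqrt_pos.2 hN0
  have hRsq : R ^ 2 = N := Real.sq_sqrt hN0.le
  have hh2 : h ^ 2 ≤ 1 / R := by
    have h1 : h ^ 2 ≤ ((N : ℝ) ^ (-α)) ^ 2 := by gcongr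
    have h2 : ((N : ℝ) ^ (-α)) ^ 2 = (N : ℝ) ^ (-(2 * α)) := by
      rw [← Real.rpow_natCast, ← Real.rpow_mul hN0.le]; congr 1; push_cast; ring
    have h3 : (N : ℝ) ^ (-(2 * α)) ≤ (N : ℝ) ^ (-(1 / 2 : ℝ)) :=
      Real.rpow_le_rpow_of_exponent_le hN1 (by linarith)
    rw [Real.rpow_neg hN0.le (1 / 2), ← Real.sqrt_eq_rpow, ← one_div] at h3
    exact (h1.trans_eq h2).trans h3
  have hμ1 : |μ0| ≤ G * h ^ 2 := by
    have ht : Real.tanh h ^ 2 ≤ h ^ 2 := sq_le_sq.2 (aux_abs_tanh_le h)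
    rw [hμ, abs_of_nonneg (by positivity)]
    gcongr
  have hmap : gaussianReal μ0 (Real.toNNReal (γ ^ 2 / N))
      = stdGaussian.map (fun g => μ0 + γ / R * g) := by
    have e1 := gaussianReal_map_const_mul (μ := 0) (v := 1) (γ / R)
    have e2 := gaussianReal_map_const_add (μ := γ / R * 0) (v := NNReal.mk ((γ / R) ^ 2) (sq_nonneg _) * 1) μ0
    rw [← e1, Measure.map_map (by fun_prop) (by fun_prop)] at e2
    have e3 : Real.toNNReal (γ ^ 2 / N) = NNReal.mk ((γ / R) ^ 2) (sq_nonneg _) * 1 := by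
      rw [mul_one]
      apply NNReal.eq
      rw [Real.coe_toNNReal _ (by positivity)]
      change _ = (γ / R) ^ 2
      rw [div_pow, hRsq]
    rw [e3]
    simp only [mul_zero, zero_add] at e2
    exact e2.symm
  have hcont : Continuous fun z => (Real.exp z * Real.sinh (2 * h) /
      (Real.exp z * Real.cosh (2 * h) + Real.exp (-z)) - q1 β h) ^ (2 * k) := by
    have hD : ∀ z, Real.exp z * Real.cosh (2 * h) + Real.exp (-z) ≠ 0 := fun z => by
      have := Real.cosh_pos (2 * h)
      positivity
    fun_prop (disch := exact hD _)
  rw [hmap, integral_map (by fun_prop) hcont.aestronglyMeasurable]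
  have key : ∀ z g : ℝ, z = μ0 + γ / R * g →
      |Real.exp z * Real.sinh (2 * h) /
      (Real.exp z * Real.cosh (2 * h) + Real.exp (-z)) - q1 β h| ≤ h / R * (Γ * |g| + A) := by
    intro z g hz
    have k1 := aux_F_lip h hh z
    have k2 := aux_tanh_sub h
    have k3 := hM h hh
    rw [abs_of_nonneg hh] at k2
    have k4 : |z| ≤ G * h ^ 2 + Γ / R * |g| := by
      rw [hz]
      refine (abs_add_le _ _).trans (add_le_add hμ1 ?_)
      rw [abs_mul, abs_of_nonneg (by positivity)]
      gcongr
    have k5 : h * |z| ≤ h * (G * h ^ 2 + Γ / R * |g|) := by gcongr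
    have k6 : A * h * h ^ 2 ≤ A * h * (1 / R) := by gcongr
    have k7 : h / R * (Γ * |g| + A) = h * (Γ / R * |g|) + A * h * (1 / R) := by ring
    rw [k7]
    have k8 : A * h * h ^ 2 = G * h ^ 3 + h ^ 3 + M * h ^ 3 := by rw [hA]; ring
    have k9 : h * (G * h ^ 2 + Γ / R * |g|) = G * h ^ 3 + h * (Γ / R * |g|) := by ring
    have k10 := abs_le.1 k1
    have k11 := abs_le.1 k2
    have k12 := abs_le.1 k3
    refine abs_le.2 ⟨?_, ?_⟩
    · linarith [k10.1, k11.1, k12.2]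
    · linarith [k10.2, k11.2, k12.1]
  have hk : (h ^ 2 / N) ^ k = (h / R) ^ (2 * k) := by
    rw [pow_mul, div_pow h R, hRsq]
  calc _ ≤ ∫ g, (h ^ 2 / N) ^ k * (Γ * |g| + A) ^ (2 * k) ∂stdGaussian := by
        refine integral_mono_of_nonneg
          (Filter.Eventually.of_forall fun g => (even_two_mul k).pow_nonneg _)
          ((aux_int Γ A hΓ0 hA0 _).const_mul _) (Filter.Eventually.of_forall fun g => ?_)
        simp only
        rw [hk, ← mul_pow, ← (even_two_mul k).pow_abs]
        exact pow_le_pow_left₀ (abs_nonneg _) (key _ g rfl) _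
    _ = (h ^ 2 / N) ^ k * ∫ g, (Γ * |g| + A) ^ (2 * k) ∂stdGaussian := integral_const_mul _ _
    _ ≤ _ := by
        have : 0 ≤ (h ^ 2 / N) ^ k := by positivity
        nlinarith
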